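/- Every nonzero prime ideal of the ring C^ω[0,1] is maximal; that is, for any prime ideal P of C^ω[0,1] with P ≠ 0, there exists γ ∈ [0,1] such that P = {f ∈ C^ω[0,1] : f(γ) = 0}. -/

import Mathlib

/-- Extension of a function on `[0,1]` to `ℝ` by zero. -/
noncomputable def extIcc (f : Set.Icc (0:ℝ) 1 → ℝ) : ℝ → ℝ :=
  fun y => if h : y ∈ Set.Icc (0:ℝ) 1 then f ⟨y, h⟩ else 0

lemma extIcc_eq (f : Set.Icc (0:ℝ) 1 → ℝ) {y : ℝ} (h : y ∈ Set.Icc (0:ℝ) 1) :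
    extIcc f y = f ⟨y, h⟩ := dif_pos h

/-- A function on `[0,1]` is real analytic on `[0,1]` if at every point of `[0,1]` it is given
by a convergent power series on a neighborhood within `[0,1]` (one-sided at endpoints). -/
def IsAnalyticOnIcc (f : Set.Icc (0:ℝ) 1 → ℝ) : Prop :=
  ∀ x : Set.Icc (0:ℝ) 1, AnalyticWithinAt ℝ (extIcc f) (Set.Icc (0:ℝ) 1) x

lemma extIcc_add (f g : Set.Icc (0:ℝ) 1 → ℝ) : extIcc (f + g) = extIcc f + extIcc g := by
  funext y; by_cases h : y ∈ Set.Icc (0:ℝ) 1 <;> simp [extIcc, h]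

lemma extIcc_mul (f g : Set.Icc (0:ℝ) 1 → ℝ) : extIcc (f * g) = extIcc f * extIcc g := by
  funext y; by_cases h : y ∈ Set.Icc (0:ℝ) 1 <;> simp [extIcc, h]

lemma extIcc_neg (f : Set.Icc (0:ℝ) 1 → ℝ) : extIcc (-f) = -extIcc f := by
  funext y; by_cases h : y ∈ Set.Icc (0:ℝ) 1 <;> simp [extIcc, h]

/-- The ring `C^ω[0,1]` of real analytic functions on `[0,1]`, as a subring of the ring of all
functions `[0,1] → ℝ` with pointwise operations. -/
noncomputable def Comega : Subring (Set.Icc (0:ℝ) 1 → ℝ) where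
  carrier := {f | IsAnalyticOnIcc f}
  zero_mem' := by
    intro x
    apply (analyticWithinAt_const (v := (0:ℝ))).congr
    · intro y hy; simp [extIcc, hy]
    · simp [extIcc, x.2]
  one_mem' := by
    intro x
    apply (analyticWithinAt_const (v := (1:ℝ))).congr
    · intro y hy; simp [extIcc, hy]
    · simp [extIcc, x.2]
  add_mem' hf hg x := by rw [extIcc_add]; exact (hf x).add (hg x)
  mul_mem' hf hg x := by rw [extIcc_mul]; exact (hf x).mul (hg x)
  neg_mem' hf x := by rw [extIcc_neg]; exact (hf x).neg

/-- The ideal `M^ω_γ = {f ∈ C^ω[0,1] : f(γ) = 0}` of `C^ω[0,1]`. -/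
noncomputable def Momega (γ : Set.Icc (0:ℝ) 1) : Ideal Comega where
  carrier := {f | (f : Set.Icc (0:ℝ) 1 → ℝ) γ = 0}
  zero_mem' := rfl
  add_mem' := by
    intro a b ha hb
    simp only [Set.mem_setOf_eq] at *
    simp [ha, hb]
  smul_mem' := by
    intro c f hf
    simp only [Set.mem_setOf_eq, smul_eq_mul] at *
    simp [hf]

open Topology Filter

/-- Analyticity on `[0,1]` in terms of local analytic extensions, in the subspace topology. -/
lemma isAnalyticOnIcc_iff {f : Set.Icc (0:ℝ) 1 → ℝ} :
    IsAnalyticOnIcc f ↔ ∀ x : Set.Icc (0:ℝ) 1, ∃ F : ℝ → ℝ,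
      AnalyticAt ℝ F x ∧ ∀ᶠ y : Set.Icc (0:ℝ) 1 in 𝓝 x, f y = F y := by
  refine forall_congr' fun x => ?_
  rw [analyticWithinAt_iff_exists_analyticAt, Set.insert_eq_of_mem x.2]
  have key (F : ℝ → ℝ) : extIcc f =ᶠ[𝓝[Set.Icc (0:ℝ) 1] (x : ℝ)] F ↔
      ∀ᶠ y : Set.Icc (0:ℝ) 1 in 𝓝 x, f y = F y := by
    rw [← map_nhds_subtype_val x, EventuallyEq, eventually_map]
    simp only [extIcc_eq f (Subtype.prop _), Subtype.coe_eta]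
  constructor
  · rintro ⟨F, h, hF⟩
    exact ⟨F, hF, (key F).1 h⟩
  · rintro ⟨F, hF, h⟩
    exact ⟨F, (key F).2 h, hF⟩

lemma IsAnalyticOnIcc.continuous {f : Set.Icc (0:ℝ) 1 → ℝ} (hf : IsAnalyticOnIcc f) :
    Continuous f := by
  rw [continuous_iff_continuousAt]
  intro x
  obtain ⟨F, hF, h⟩ := isAnalyticOnIcc_iff.1 hf x
  exact (ContinuousAt.comp (f := ((↑) : Set.Icc (0:ℝ) 1 → ℝ)) hF.continuousAt
    continuousAt_subtype_val).congr (h.mono fun _ hy => hy.symm)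

lemma IsAnalyticOnIcc.inv {f : Set.Icc (0:ℝ) 1 → ℝ} (hf : IsAnalyticOnIcc f)
    (h0 : ∀ x, f x ≠ 0) : IsAnalyticOnIcc f⁻¹ := by
  rw [isAnalyticOnIcc_iff] at hf ⊢
  intro x
  obtain ⟨F, hF, h⟩ := hf x
  refine ⟨F⁻¹, hF.inv (h.self_of_nhds ▸ h0 x), h.mono fun y hy => ?_⟩
  simp [hy]

lemma Comega.isUnit_of_ne_zero (f : Comega) (h0 : ∀ x, (f : Set.Icc (0:ℝ) 1 → ℝ) x ≠ 0) :
    IsUnit f := by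
  refine IsUnit.of_mul_eq_one ⟨_, IsAnalyticOnIcc.inv f.2 h0⟩ (Subtype.ext (funext fun x => ?_))
  exact mul_inv_cancel₀ (h0 x)

/-- The function `x ↦ x - a` as an element of `C^ω[0,1]`. -/
noncomputable def Comega.subConst (a : ℝ) : Comega :=
  ⟨fun x => x - a, isAnalyticOnIcc_iff.2 fun _ =>
    ⟨fun y => y - a, by fun_prop, Eventually.of_forall fun _ => rfl⟩⟩

/-- A local factorization of `f` at `γ` by a power of `x - γ` extends to `[0,1]`. -/
lemma Comega.exists_eq_subConst_pow_mul (f : Comega) (γ : Set.Icc (0:ℝ) 1) (n : ℕ) {G : ℝ → ℝ}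
    (hG : AnalyticAt ℝ G γ) (h : ∀ᶠ y : Set.Icc (0:ℝ) 1 in 𝓝 γ,
      (f : Set.Icc (0:ℝ) 1 → ℝ) y = ((y : ℝ) - γ) ^ n * G y) :
    ∃ u : Comega, f = Comega.subConst γ ^ n * u ∧ (u : Set.Icc (0:ℝ) 1 → ℝ) γ = G γ := by
  classical
  have hne {y : Set.Icc (0:ℝ) 1} (hy : y ≠ γ) : ((y : ℝ) - γ) ^ n ≠ 0 :=
    pow_ne_zero _ (sub_ne_zero.2 fun e => hy (Subtype.ext e))
  let u : Set.Icc (0:ℝ) 1 → ℝ := fun y =>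
    if y = γ then G γ else (f : Set.Icc (0:ℝ) 1 → ℝ) y / ((y : ℝ) - γ) ^ n
  have hu : IsAnalyticOnIcc u := by
    rw [isAnalyticOnIcc_iff]
    intro x
    by_cases hx : x = γ
    · subst hx
      refine ⟨G, hG, h.mono fun y hy => ?_⟩
      by_cases hyx : y = x
      · simp [u, hyx]
      · simp only [u, if_neg hyx, hy]
        exact mul_div_cancel_left₀ _ (hne hyx)
    · obtain ⟨F, hF, hfF⟩ := isAnalyticOnIcc_iff.1 f.2 x
      refine ⟨fun y => F y / (y - γ) ^ n, hF.div (by fun_prop) (hne hx), ?_⟩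
      filter_upwards [hfF, isOpen_ne.mem_nhds hx] with y hy hyγ
      simp only [u, if_neg hyγ, hy]
  refine ⟨⟨u, hu⟩, Subtype.ext (funext fun y => ?_), if_pos rfl⟩
  change (f : Set.Icc (0:ℝ) 1 → ℝ) y = ((y : ℝ) - γ) ^ n * u y
  by_cases hy : y = γ
  · subst hy
    simpa [u] using h.self_of_nhds
  · simp only [u, if_neg hy]
    exact (mul_div_cancel₀ _ (hne hy)).symm

/-- The identity theorem on `[0,1]`. -/
lemma Comega.eq_zero_of_eventually_eq_zero (f : Comega) (γ : Set.Icc (0:ℝ) 1)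
    (h : ∀ᶠ y in 𝓝 γ, (f : Set.Icc (0:ℝ) 1 → ℝ) y = 0) : f = 0 := by
  let S : Set (Set.Icc (0:ℝ) 1) := {x | ∀ᶠ y in 𝓝 x, (f : Set.Icc (0:ℝ) 1 → ℝ) y = 0}
  have hclosed : IsClosed S := by
    rw [← isOpen_compl_iff, isOpen_iff_mem_nhds]
    intro x hx
    obtain ⟨F, hF, hfF⟩ := isAnalyticOnIcc_iff.1 f.2 x
    have hval : Tendsto ((↑) : Set.Icc (0:ℝ) 1 → ℝ) (𝓝 x) (𝓝 (x : ℝ)) :=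
      continuousAt_subtype_val
    rcases hF.eventually_eq_zero_or_eventually_ne_zero with h0 | h0
    · refine absurd ?_ hx
      filter_upwards [hfF, hval.eventually h0] with y hy hy0
      rw [hy, hy0]
    · rw [eventually_nhdsWithin_iff] at h0
      filter_upwards [hfF, hval.eventually h0] with y hy hy0 hyS
      by_cases hyx : y = x
      · exact hx (hyx ▸ hyS)
      · exact hy0 (fun e => hyx (Subtype.ext e)) (hy ▸ hyS.self_of_nhds)
  have : PreconnectedSpace (Set.Icc (0:ℝ) 1) := Subtype.preconnectedSpace isPreconnected_Icc
  have hS : S = Set.univ := IsClopen.eq_univ ⟨hclosed, isOpen_setOfPred_eventually_nhds⟩ ⟨γ, h⟩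
  refine Subtype.ext (funext fun x => ?_)
  have hx : x ∈ S := hS ▸ Set.mem_univ x
  exact hx.self_of_nhds

lemma Comega.exists_eq_subConst_pow_mul_of_ne_zero {f : Comega} (hf : f ≠ 0)
    (γ : Set.Icc (0:ℝ) 1) :
    ∃ (n : ℕ) (u : Comega), f = Comega.subConst γ ^ n * u ∧
      (u : Set.Icc (0:ℝ) 1 → ℝ) γ ≠ 0 := by
  obtain ⟨F, hF, hfF⟩ := isAnalyticOnIcc_iff.1 f.2 γ
  have hval : Tendsto ((↑) : Set.Icc (0:ℝ) 1 → ℝ) (𝓝 γ) (𝓝 (γ : ℝ)) :=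
    continuousAt_subtype_val
  have hF0 : ¬ ∀ᶠ z in 𝓝 (γ : ℝ), F z = 0 := fun h0 => hf <|
    eq_zero_of_eventually_eq_zero f γ <| by
      filter_upwards [hfF, hval.eventually h0] with y hy hy0
      rw [hy, hy0]
  obtain ⟨n, G, hG, hGγ, hFG⟩ := hF.exists_eventuallyEq_pow_smul_nonzero_iff.2 hF0
  obtain ⟨u, hu, huγ⟩ := exists_eq_subConst_pow_mul f γ n hG <| by
    filter_upwards [hfF, hval.eventually hFG] with y hy hy'
    rw [hy, hy', smul_eq_mul]
  exact ⟨n, u, hu, huγ ▸ hGγ⟩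

lemma Comega.subConst_dvd {f : Comega} {γ : Set.Icc (0:ℝ) 1}
    (hf : (f : Set.Icc (0:ℝ) 1 → ℝ) γ = 0) : Comega.subConst γ ∣ f := by
  rcases eq_or_ne f 0 with rfl | hne
  · exact dvd_zero _
  obtain ⟨n, u, hu, huγ⟩ := exists_eq_subConst_pow_mul_of_ne_zero hne γ
  rcases n with _ | n
  · rw [pow_zero, one_mul] at hu
    exact absurd (hu ▸ hf) huγ
  · rw [hu]
    exact (dvd_pow_self _ n.succ_ne_zero).mul_right u

/-- By compactness, a proper ideal of `C^ω[0,1]` has a common zero. -/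
lemma Comega.exists_le_Momega {I : Ideal Comega} (hI : I ≠ ⊤) :
    ∃ γ : Set.Icc (0:ℝ) 1, I ≤ Momega γ := by
  by_contra! hcon
  have hex (γ : Set.Icc (0:ℝ) 1) : ∃ p ∈ I, (p : Set.Icc (0:ℝ) 1 → ℝ) γ ≠ 0 :=
    Set.not_subset.1 (hcon γ)
  choose p hpI hp using hex
  obtain ⟨t, ht⟩ := CompactSpace.elim_nhds_subcover
    (fun γ => {x | (p γ : Set.Icc (0:ℝ) 1 → ℝ) x ≠ 0})
    (fun γ => (IsAnalyticOnIcc.continuous (p γ).2).continuousAt.eventually_ne (hp γ))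
  refine hI (I.eq_top_of_isUnit_mem (x := ∑ γ ∈ t, p γ * p γ)
    (I.sum_mem fun γ _ => I.mul_mem_left _ (hpI γ)) (isUnit_of_ne_zero _ fun x => ?_))
  have hx : x ∈ ⋃ γ ∈ t, {x | (p γ : Set.Icc (0:ℝ) 1 → ℝ) x ≠ 0} := by rw [ht]; trivial
  simp only [Set.mem_iUnion] at hx
  obtain ⟨γ, hγ, hγx⟩ := hx
  have hsum : ((∑ γ ∈ t, p γ * p γ : Comega) : Set.Icc (0:ℝ) 1 → ℝ) x =
      ∑ γ ∈ t, (p γ : Set.Icc (0:ℝ) 1 → ℝ) x * (p γ : Set.Icc (0:ℝ) 1 → ℝ) x := by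
    simp [Finset.sum_apply]
  rw [hsum]
  refine ne_of_gt (Finset.sum_pos' (fun i _ => mul_self_nonneg _) ⟨γ, hγ, mul_self_pos.2 hγx⟩)

/-- Every nonzero prime ideal of C^ω[0,1] is maximal: it equals
M^ω_γ = {f : f(γ) = 0} for some γ ∈ [0,1]. -/
theorem prime_ideal_eq_Momega (P : Ideal Comega) (hP : P.IsPrime) (hne : P ≠ ⊥) :
    ∃ γ : Set.Icc (0:ℝ) 1, P = Momega γ := by
  obtain ⟨γ, hγ⟩ := Comega.exists_le_Momega hP.ne_top
  obtain ⟨f, hfP, hf0⟩ := Submodule.exists_mem_ne_zero_of_ne_bot hne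
  obtain ⟨n, u, rfl, huγ⟩ := Comega.exists_eq_subConst_pow_mul_of_ne_zero hf0 γ
  have hX : Comega.subConst γ ∈ P :=
    hP.mem_of_pow_mem n ((hP.mem_or_mem hfP).resolve_right fun hu => huγ (hγ hu))
  exact ⟨γ, hγ.antisymm fun _ hg => P.mem_of_dvd (Comega.subConst_dvd hg) hX⟩
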